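/- Let c : ℕ → ℝ≥0 be a function, and assume that for every pair of finite sets X, Y and every boolean function f : X × Y → {-1,1} of rank r' ≥ 1 there exists a rectangle R on which f is constant with |R| ≥ 2^{-c(r')}·|X × Y|. Then there is an absolute constant C > 0 such that every boolean function f : X × Y → {-1,1} of rank r ≥ 2 admits a partition of X × Y into at most 2^{C·(log²r + Σ_{i=0}^{⌈log₂ r⌉} c(⌈r/2^i⌉))} rectangles on each of which f is constant. (This is the combinatorial form of the Nisan–Wigderson theorem: the corresponding deterministic protocol has complexity O(log²r + Σ_{i=0}^{log r} c(r/2^i)).) -/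

import Mathlib

open Finset

/-- `f` has a partition into at most `n` monochromatic rectangles (fibres of a labelling). -/
def NWPart {X Y : Type} (f : X → Y → ℝ) (n : ℕ) : Prop :=
  ∃ φ : X → Y → Fin n, (∀ x y x' y', φ x y = φ x' y' → φ x y' = φ x y) ∧
    (∀ x y x' y', φ x y = φ x' y' → f x y = f x' y')

lemma NWPart.of_map {X Y : Type} {f : X → Y → ℝ} {T : Type} [Fintype T] (φ : X → Y → T)
    (h1 : ∀ x y x' y', φ x y = φ x' y' → φ x y' = φ x y)
    (h2 : ∀ x y x' y', φ x y = φ x' y' → f x y = f x' y') {n : ℕ} (hn : Fintype.card T ≤ n) :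
    NWPart f n := by
  have e : T ↪ Fin n := (Fintype.equivFin T).toEmbedding.trans (Fin.castLEEmb hn)
  refine ⟨fun x y => e (φ x y), ?_, ?_⟩
  · intro x y x' y' h
    exact congrArg e (h1 x y x' y' (e.injective h))
  · intro x y x' y' h
    exact h2 x y x' y' (e.injective h)

lemma NWPart.mono {X Y : Type} {f : X → Y → ℝ} {n m : ℕ} (h : NWPart f n) (hnm : n ≤ m) :
    NWPart f m := by
  obtain ⟨φ, h1, h2⟩ := h
  exact NWPart.of_map φ h1 h2 (by simpa using hnm)

lemma NWPart.trivial {X Y : Type} [Fintype X] [Fintype Y] (f : X → Y → ℝ) :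
    NWPart f (Fintype.card X * Fintype.card Y) := by
  refine NWPart.of_map (fun x y => (x, y)) ?_ ?_ (by simp)
  · intro x y x' y' h
    simp only [Prod.mk.injEq] at h ⊢
    exact ⟨True.intro, h.2.symm⟩
  · intro x y x' y' h
    simp only [Prod.mk.injEq] at h
    rw [h.1, h.2]

lemma NWPart.comap {X Y X' Y' : Type} {f' : X' → Y' → ℝ} {n : ℕ} (h : NWPart f' n)
    (a : X → X') (b : Y → Y') : NWPart (fun x y => f' (a x) (b y)) n := by
  obtain ⟨φ, h1, h2⟩ := h
  exact ⟨fun x y => φ (a x) (b y), fun x y x' y' => h1 _ _ _ _, fun x y x' y' => h2 _ _ _ _⟩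

lemma NWPart.transpose {X Y : Type} {f : X → Y → ℝ} {n : ℕ} (h : NWPart f n) :
    NWPart (fun y x => f x y) n := by
  obtain ⟨φ, h1, h2⟩ := h
  refine ⟨fun y x => φ x y, fun x y x' y' h => ?_, fun x y x' y' h => h2 _ _ _ _ h⟩
  exact (h1 _ _ _ _ h.symm).trans h.symm

lemma NWPart.rows {X Y : Type} {f : X → Y → ℝ} {n m : ℕ} (A : Finset X)
    (h : NWPart (fun (x : {x // x ∈ A}) y => f x.1 y) n)
    (h' : NWPart (fun (x : {x // x ∉ A}) y => f x.1 y) m) : NWPart f (n + m) := by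
  classical
  obtain ⟨φ, h1, h2⟩ := h
  obtain ⟨ψ, k1, k2⟩ := h'
  refine NWPart.of_map (T := Fin n ⊕ Fin m)
    (fun x y => if hx : x ∈ A then Sum.inl (φ ⟨x, hx⟩ y) else Sum.inr (ψ ⟨x, hx⟩ y)) ?_ ?_ (by simp)
  · intro x y x' y' h
    by_cases hx : x ∈ A <;> by_cases hx' : x' ∈ A <;> simp [hx, hx'] at h ⊢
    · exact h1 _ _ _ _ h
    · exact k1 _ _ _ _ h
  · intro x y x' y' h
    by_cases hx : x ∈ A <;> by_cases hx' : x' ∈ A <;> simp [hx, hx'] at h ⊢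
    · exact h2 _ _ _ _ h
    · exact k2 _ _ _ _ h

lemma NWPart.cols {X Y : Type} {f : X → Y → ℝ} {n m : ℕ} (B : Finset Y)
    (h : NWPart (fun x (y : {y // y ∈ B}) => f x y.1) n)
    (h' : NWPart (fun x (y : {y // y ∉ B}) => f x y.1) m) : NWPart f (n + m) :=
  (NWPart.rows (f := fun y x => f x y) B h.transpose h'.transpose).transpose

lemma NWPart.toFinset {X Y : Type} [Fintype X] [Fintype Y] {f : X → Y → ℝ} {n : ℕ}
    (h : NWPart f n) :
    ∃ P : Finset (Finset X × Finset Y),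
      (∀ p : X × Y, ∃! R, R ∈ P ∧ p.1 ∈ R.1 ∧ p.2 ∈ R.2) ∧
      (∀ R ∈ P, ∀ p q : X × Y,
        p.1 ∈ R.1 → p.2 ∈ R.2 → q.1 ∈ R.1 → q.2 ∈ R.2 → f p.1 p.2 = f q.1 q.2) ∧
      P.card ≤ n := by
  classical
  obtain ⟨φ, h1, h2⟩ := h
  let F : Fin n → Finset X × Finset Y := fun k =>
    (univ.filter fun x => ∃ y, φ x y = k, univ.filter fun y => ∃ x, φ x y = k)
  have key : ∀ k x y, x ∈ (F k).1 → y ∈ (F k).2 → φ x y = k := by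
    intro k x y hx hy
    simp only [F, mem_filter, mem_univ, true_and] at hx hy
    obtain ⟨y', hy'⟩ := hx
    obtain ⟨x', hx'⟩ := hy
    rw [h1 x y' x' y (hy'.trans hx'.symm), hy']
  refine ⟨univ.image F, ?_, ?_, ?_⟩
  · rintro ⟨x, y⟩
    refine ⟨F (φ x y), ⟨mem_image_of_mem _ (mem_univ _), ?_, ?_⟩, ?_⟩
    · simp only [F, mem_filter, mem_univ, true_and]; exact ⟨y, rfl⟩
    · simp only [F, mem_filter, mem_univ, true_and]; exact ⟨x, rfl⟩
    · rintro R ⟨hR, hx, hy⟩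
      obtain ⟨k, -, rfl⟩ := mem_image.1 hR
      rw [key k x y hx hy]
  · intro R hR p q hp1 hp2 hq1 hq2
    obtain ⟨k, -, rfl⟩ := mem_image.1 hR
    exact h2 _ _ _ _ ((key k _ _ hp1 hp2).trans (key k _ _ hq1 hq2).symm)
  · exact card_image_le.trans (by simp)

/-- ±1 valued -/
def NWSign {X Y : Type} (f : X → Y → ℝ) : Prop := ∀ x y, f x y = 1 ∨ f x y = -1

/-- rank -/
noncomputable def nwrk {X Y : Type} [Fintype Y] (f : X → Y → ℝ) : ℕ := (Matrix.of f).rank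

lemma nwrk_comap {X Y X' Y' : Type} [Fintype Y] [Fintype Y'] (f : X → Y → ℝ)
    (a : X' → X) (b : Y' → Y) : nwrk (fun x y => f (a x) (b y)) ≤ nwrk f :=
  Matrix.rank_submatrix_le (Matrix.of f) a b

lemma nwrk_transpose {X Y : Type} [Fintype X] [Fintype Y] (f : X → Y → ℝ) :
    nwrk (fun y x => f x y) = nwrk f :=
  Matrix.rank_transpose (Matrix.of f)

lemma nwrk_span {X Y : Type} [Fintype Y] (f : X → Y → ℝ) :
    nwrk f = Module.finrank ℝ (Submodule.span ℝ (Set.range fun y x => f x y)) :=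
  Matrix.rank_eq_finrank_span_cols (Matrix.of f)

/-- Frobenius-type inequality. -/
lemma nwrk_frob {X Y A B : Type} [Fintype X] [Fintype Y] [Fintype A] [Fintype B] (f : X → Y → ℝ)
    (a : A → X) (b : B → Y) :
    nwrk (fun i y => f (a i) y) + nwrk (fun x j => f x (b j)) ≤
      nwrk f + nwrk (fun i j => f (a i) (b j)) := by
  simp only [nwrk_span]
  let π : (X → ℝ) →ₗ[ℝ] (A → ℝ) := LinearMap.funLeft ℝ ℝ a
  set V := Submodule.span ℝ (Set.range fun y x => f x y) with hV
  set W := Submodule.span ℝ (Set.range fun (j : B) x => f x (b j)) with hW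
  have hWV : W ≤ V := Submodule.span_mono (by rintro _ ⟨j, rfl⟩; exact ⟨b j, rfl⟩)
  have e1 : Submodule.span ℝ (Set.range fun y (i : A) => f (a i) y) = V.map π := by
    rw [hV, Submodule.map_span, ← Set.range_comp]; rfl
  have e2 : Submodule.span ℝ (Set.range fun (j : B) (i : A) => f (a i) (b j)) = W.map π := by
    rw [hW, Submodule.map_span, ← Set.range_comp]; rfl
  rw [e1, e2]
  have key : ∀ U : Submodule ℝ (X → ℝ), Module.finrank ℝ (U.map π) +
      Module.finrank ℝ (U ⊓ LinearMap.ker π : Submodule ℝ (X → ℝ)) = Module.finrank ℝ U := by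
    intro U
    have := LinearMap.finrank_range_add_finrank_ker (π.domRestrict U)
    rw [LinearMap.range_domRestrict, LinearMap.ker_domRestrict] at this
    rw [← this, ← Submodule.finrank_map_subtype_eq, Submodule.map_comap_subtype]
  have k1 := key V
  have k2 := key W
  have := Submodule.finrank_mono (inf_le_inf_right (LinearMap.ker π) hWV)
  omega

lemma nwrk_const {X Y : Type} [Fintype X] [Fintype Y] (f : X → Y → ℝ)
    (h : ∀ x y x' y', f x y = f x' y') : nwrk f ≤ 1 := by
  have : ∃ t, f = fun _ _ => t := by
    by_cases hne : Nonempty X ∧ Nonempty Y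
    · obtain ⟨⟨x⟩, ⟨y⟩⟩ := hne
      exact ⟨f x y, by funext x' y'; exact h _ _ _ _⟩
    · refine ⟨0, ?_⟩
      funext x y
      exact absurd ⟨⟨x⟩, ⟨y⟩⟩ hne
  obtain ⟨t, rfl⟩ := this
  have := Matrix.rank_vecMulVec_le (fun _ : X => t) (fun _ : Y => (1:ℝ))
  refine le_trans (le_of_eq ?_) this
  unfold nwrk
  congr 1
  ext i j
  simp [Matrix.vecMulVec_apply]

lemma nw_dedup_rows {X Y : Type} [Fintype X] [Fintype Y] (f : X → Y → ℝ) (hf : NWSign f) :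
    ∃ (X' : Type) (_ : Fintype X') (a : X → X') (b : X' → X),
      (∀ x y, f (b (a x)) y = f x y) ∧ Fintype.card X' ≤ 2 ^ nwrk f := by
  classical
  rw [nwrk_span]
  obtain ⟨g, hg1, hg2, -⟩ := Submodule.exists_fun_fin_finrank_span_eq ℝ
    (Set.range fun y x => f x y)
  generalize Module.finrank ℝ (Submodule.span ℝ (Set.range fun y x => f x y)) = d at g hg1 hg2 ⊢
  let α : X → (Fin d → Bool) := fun x i => decide (g i x = 1)
  have hsep : ∀ x x', α x = α x' → ∀ y, f x y = f x' y := by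
    intro x x' h y
    let L : (X → ℝ) →ₗ[ℝ] ℝ := 
      LinearMap.proj (R := ℝ) (φ := fun _ : X => ℝ) x - LinearMap.proj (R := ℝ) (φ := fun _ : X => ℝ) x'
    have hle : Submodule.span ℝ (Set.range g) ≤ LinearMap.ker L := by
      rw [Submodule.span_le]
      rintro _ ⟨i, rfl⟩
      obtain ⟨y', hy'⟩ := hg1 i
      have hi := congrFun h i
      simp only [α, decide_eq_decide] at hi
      simp only [SetLike.mem_coe, LinearMap.mem_ker, L, LinearMap.sub_apply, LinearMap.proj_apply]
      rw [← hy'] at hi ⊢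
      simp only at hi ⊢
      rcases hf x y' with h1 | h1 <;> rcases hf x' y' with h2 | h2 <;> rw [h1, h2] at hi ⊢ <;>
        first | (norm_num; done) | (norm_num at hi; done)
    have hm : (fun x => f x y) ∈ Submodule.span ℝ (Set.range g) := by
      rw [hg2]; exact Submodule.subset_span ⟨y, rfl⟩
    have := hle hm
    simp only [LinearMap.mem_ker, L, LinearMap.sub_apply, LinearMap.proj_apply] at this
    linarith
  refine ⟨Set.range α, inferInstance, fun x => ⟨α x, x, rfl⟩, fun z => z.2.choose, ?_, ?_⟩
  · intro x y
    exact hsep _ _ (Exists.choose_spec (p := fun z => α z = α x) _) y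
  · refine (Fintype.card_subtype_le _).trans ?_
    simp

lemma nw_dedup {X Y : Type} [Fintype X] [Fintype Y] (f : X → Y → ℝ) (hf : NWSign f) :
    ∃ (X' Y' : Type) (_ : Fintype X') (_ : Fintype Y') (f' : X' → Y' → ℝ),
      NWSign f' ∧ nwrk f' ≤ nwrk f ∧ Fintype.card X' ≤ 2 ^ nwrk f ∧ Fintype.card Y' ≤ 2 ^ nwrk f ∧
      ∀ n, NWPart f' n → NWPart f n := by
  obtain ⟨X', _, a, b, hab, hc⟩ := nw_dedup_rows f hf
  obtain ⟨Y', _, a', b', hab', hc'⟩ := nw_dedup_rows (fun y x => f x y) (fun y x => hf x y)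
  rw [nwrk_transpose] at hc'
  refine ⟨X', Y', inferInstance, inferInstance, fun x y => f (b x) (b' y), fun x y => hf _ _,
    nwrk_comap _ _ _, hc, hc', ?_⟩
  intro n h
  have := h.comap a a'
  convert this using 3 with x y
  rw [hab, hab']

/-- One step of the main recursion: peel off rectangles. -/
lemma nw_peel (t N : ℕ) (δ : ℝ) (hδ1 : δ ≤ 1)
    (H1 : ∀ (X Y : Type) [Fintype X] [Fintype Y] (f : X → Y → ℝ), NWSign f → nwrk f ≤ t →
      ∃ (A : Finset X) (B : Finset Y),
        (∀ x ∈ A, ∀ y ∈ B, ∀ x' ∈ A, ∀ y' ∈ B, f x y = f x' y') ∧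
        δ * (Fintype.card X * Fintype.card Y) ≤ (A.card * B.card : ℝ))
    (H2 : ∀ (X Y : Type) [Fintype X] [Fintype Y] (f : X → Y → ℝ), NWSign f →
      nwrk f ≤ (t + 1) / 2 → NWPart f N) (j : ℕ) :
    ∀ (X Y : Type) [Fintype X] [Fintype Y] (f : X → Y → ℝ), NWSign f → nwrk f ≤ t →
      (1 - δ) ^ j * (Fintype.card X * Fintype.card Y) < 1 → NWPart f (j * N) := by
  classical
  induction j with
  | zero =>
    intro X Y _ _ f hf hr hc
    refine (NWPart.trivial f).mono ?_
    rw [pow_zero, one_mul] at hc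
    have : Fintype.card X * Fintype.card Y < 1 := by exact_mod_cast hc
    omega
  | succ j ih =>
    intro X Y _ _ f hf hr hc
    obtain ⟨A, B, hconst, hcard⟩ := H1 X Y f hf hr
    have hfrob := nwrk_frob f (fun i : {x // x ∈ A} => i.1) (fun i : {y // y ∈ B} => i.1)
    have hone := nwrk_const (fun (i : {x // x ∈ A}) (k : {y // y ∈ B}) => f i.1 k.1)
      (fun x y x' y' => hconst _ x.2 _ y.2 _ x'.2 _ y'.2)
    have hA : (A.card : ℝ) ≤ Fintype.card X := by exact_mod_cast card_le_univ A
    have hB : (B.card : ℝ) ≤ Fintype.card Y := by exact_mod_cast card_le_univ B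
    have hpow : 0 ≤ (1 - δ) ^ j := pow_nonneg (by linarith) _
    rw [show (j + 1) * N = N + j * N by ring]
    by_cases hcase : nwrk (fun (i : {x // x ∈ A}) y => f i.1 y) ≤ (t + 1) / 2
    · refine NWPart.rows A (H2 _ _ _ (fun x y => hf _ _) hcase) (ih _ _ _ (fun x y => hf _ _)
        ((nwrk_comap f _ id).trans hr) ?_)
      refine lt_of_le_of_lt ?_ hc
      rw [pow_succ, mul_assoc]
      refine mul_le_mul_of_nonneg_left ?_ hpow
      have : (Fintype.card {x // x ∉ A} : ℝ) = Fintype.card X - A.card := by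
        rw [Fintype.card_subtype_compl, Fintype.card_coe, Nat.cast_sub (card_le_univ A)]
      rw [this]
      have := mul_le_mul_of_nonneg_left hB (Nat.cast_nonneg (α := ℝ) A.card)
      nlinarith
    · have hcase' : nwrk (fun x (i : {y // y ∈ B}) => f x i.1) ≤ (t + 1) / 2 := by omega
      refine NWPart.cols B (H2 _ _ _ (fun x y => hf _ _) hcase') (ih _ _ _ (fun x y => hf _ _)
        ((nwrk_comap f id _).trans hr) ?_)
      refine lt_of_le_of_lt ?_ hc
      rw [pow_succ, mul_assoc]
      refine mul_le_mul_of_nonneg_left ?_ hpow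
      have : (Fintype.card {y // y ∉ B} : ℝ) = Fintype.card Y - B.card := by
        rw [Fintype.card_subtype_compl, Fintype.card_coe, Nat.cast_sub (card_le_univ B)]
      rw [this]
      have := mul_le_mul_of_nonneg_right hA (Nat.cast_nonneg (α := ℝ) B.card)
      nlinarith

lemma nw_step (t N : ℕ) (ht : 1 ≤ t) (δ : ℝ) (hδ : 0 < δ) (hδ1 : δ ≤ 1)
    (H1 : ∀ (X Y : Type) [Fintype X] [Fintype Y] (f : X → Y → ℝ), NWSign f → nwrk f ≤ t →
      ∃ (A : Finset X) (B : Finset Y),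
        (∀ x ∈ A, ∀ y ∈ B, ∀ x' ∈ A, ∀ y' ∈ B, f x y = f x' y') ∧
        δ * (Fintype.card X * Fintype.card Y) ≤ (A.card * B.card : ℝ))
    (H2 : ∀ (X Y : Type) [Fintype X] [Fintype Y] (f : X → Y → ℝ), NWSign f →
      nwrk f ≤ (t + 1) / 2 → NWPart f N)
    (X Y : Type) [Fintype X] [Fintype Y] (f : X → Y → ℝ) (hf : NWSign f) (hr : nwrk f ≤ t) :
    NWPart f (⌈2 * t / δ⌉₊ * N) := by
  obtain ⟨X', Y', _, _, f', hf', hr', hX, hY, himp⟩ := nw_dedup f hf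
  refine himp _ (nw_peel t N δ hδ1 H1 H2 _ X' Y' f' hf' (hr'.trans hr) ?_)
  set j := ⌈2 * t / δ⌉₊
  have hj : 2 * t ≤ δ * j := by
    have := Nat.le_ceil (2 * t / δ)
    rw [div_le_iff₀ hδ] at this
    linarith
  have h1 : (1 - δ) ^ j ≤ Real.exp (-(2 * t)) := by
    calc (1 - δ) ^ j ≤ (Real.exp (-δ)) ^ j :=
          pow_le_pow_left₀ (by linarith) (Real.one_sub_le_exp_neg δ) _
      _ = Real.exp (-(δ * j)) := by rw [← Real.exp_nat_mul]; congr 1; ring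
      _ ≤ _ := by apply Real.exp_le_exp.2; linarith
  have h2 : ∀ Z : Type, ∀ _ : Fintype Z, Fintype.card Z ≤ 2 ^ nwrk f →
      (Fintype.card Z : ℝ) ≤ 2 ^ t := by
    intro Z _ hZ
    have : Fintype.card Z ≤ 2 ^ t := hZ.trans (Nat.pow_le_pow_right (by norm_num) hr)
    exact_mod_cast this
  have h3 : (Fintype.card X' * Fintype.card Y' : ℝ) ≤ 2 ^ t * 2 ^ t :=
    mul_le_mul (h2 _ _ hX) (h2 _ _ hY) (by positivity) (by positivity)
  have h4 : (2 : ℝ) ^ t < Real.exp t := by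
    rw [← Real.exp_one_pow]
    exact pow_lt_pow_left₀ (by have := Real.exp_one_gt_d9; linarith) (by norm_num) (by omega)
  calc (1 - δ) ^ j * (Fintype.card X' * Fintype.card Y' : ℝ)
      ≤ Real.exp (-(2 * t)) * (2 ^ t * 2 ^ t) :=
        mul_le_mul h1 h3 (by positivity) (by positivity)
    _ < Real.exp (-(2 * t)) * (Real.exp t * Real.exp t) := by
        gcongr
    _ = 1 := by rw [← Real.exp_add, ← Real.exp_add]; simp; ring

/-- Adding sign columns to increase the rank. -/
lemma nw_extend {X : Type} [Fintype X] (V : Submodule ℝ (X → ℝ)) (k : ℕ)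
    (hk : Module.finrank ℝ V + k ≤ Fintype.card X) :
    ∃ g : Fin k → X → ℝ, (∀ i x, g i x = 1 ∨ g i x = -1) ∧
      Module.finrank ℝ (V ⊔ Submodule.span ℝ (Set.range g) : Submodule ℝ (X → ℝ)) =
        Module.finrank ℝ V + k := by
  classical
  induction k with
  | zero => exact ⟨Fin.elim0, fun i => i.elim0, by
      rw [Set.range_eq_empty, Submodule.span_empty, sup_bot_eq, add_zero]⟩
  | succ k ih =>
    obtain ⟨g, hg, hrk⟩ := ih (by omega)
    set U := V ⊔ Submodule.span ℝ (Set.range g) with hU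
    have hne : ∃ v : X → ℝ, (∀ x, v x = 1 ∨ v x = -1) ∧ v ∉ U := by
      by_contra! hcon
      have htop : U = ⊤ := by
        rw [eq_top_iff, ← (Pi.basisFun ℝ X).span_eq, Submodule.span_le]
        rintro _ ⟨x, rfl⟩
        have h1 : (fun _ => 1 : X → ℝ) ∈ U := hcon _ (fun _ => Or.inl rfl)
        have h2 : (fun z => if z = x then -1 else 1 : X → ℝ) ∈ U := hcon _ (fun z => by
          by_cases h : z = x <;> simp [h])
        have h3 := U.smul_mem (1 / 2 : ℝ) (U.sub_mem h1 h2)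
        refine (congrArg (fun w => w ∈ U) ?_).mpr h3
        ext z
        by_cases h : z = x
        · subst h; norm_num [Pi.basisFun_apply]
        · simp [Pi.basisFun_apply, h]
      rw [htop, finrank_top, Module.finrank_pi] at hrk
      omega
    obtain ⟨v, hv, hvU⟩ := hne
    refine ⟨Fin.cons v g, ?_, ?_⟩
    · intro i x
      refine Fin.cases ?_ (fun i => ?_) i
      · simpa using hv x
      · simpa using hg i x
    · rw [Fin.range_cons, Submodule.span_insert, sup_left_comm, ← hU]
      have hv0 : v ≠ 0 := fun h => hvU (h ▸ U.zero_mem)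
      have hdis : Submodule.span ℝ {v} ⊓ U = ⊥ := by
        rw [← disjoint_iff, disjoint_comm]
        exact (Submodule.disjoint_span_singleton' hv0).2 hvU
      have := Submodule.finrank_sup_add_finrank_inf_eq (Submodule.span ℝ {v}) U
      rw [hdis, finrank_bot, finrank_span_singleton hv0] at this
      omega

lemma nw_density (c : ℕ → NNReal)
    (hmono : ∀ (X Y : Type) [Fintype X] [Fintype Y] (f : X × Y → ℝ),
      (∀ p, f p = 1 ∨ f p = -1) →
      ∀ r' : ℕ, 1 ≤ r' → (Matrix.of fun x y => f (x, y)).rank = r' →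
        ∃ (A : Finset X) (B : Finset Y),
          (∀ p q : X × Y, p.1 ∈ A → p.2 ∈ B → q.1 ∈ A → q.2 ∈ B → f p = f q) ∧
          ((A.card * B.card : ℕ) : ℝ) ≥
            2 ^ (-(c r' : ℝ)) * (Fintype.card X * Fintype.card Y : ℕ))
    (s : ℕ) (hs : 1 ≤ s)
    (X Y : Type) [Fintype X] [Fintype Y] (f : X → Y → ℝ) (hf : NWSign f) (hr : nwrk f ≤ s) :
      ∃ (A : Finset X) (B : Finset Y),
        (∀ x ∈ A, ∀ y ∈ B, ∀ x' ∈ A, ∀ y' ∈ B, f x y = f x' y') ∧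
        (2 ^ (-(c s : ℝ)) / 2) * (Fintype.card X * Fintype.card Y) ≤ (A.card * B.card : ℝ) := by
  classical
  rcases isEmpty_or_nonempty X with hX | hX
  · exact ⟨∅, ∅, by simp, by simp⟩
  rcases isEmpty_or_nonempty Y with hY | hY
  · exact ⟨∅, ∅, by simp, by simp⟩
  set δ : ℝ := 2 ^ (-(c s : ℝ)) with hδ
  have hδ0 : 0 < δ := by positivity
  obtain ⟨M, hM⟩ := exists_nat_ge (2 * s / δ)
  rw [div_le_iff₀ hδ0] at hM
  have hs' : (1 : ℝ) ≤ s := by exact_mod_cast hs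
  have hM0 : 0 < M := by
    rcases Nat.eq_zero_or_pos M with h | h
    · subst h; simp at hM; linarith
    · exact h
  let f0 : X × Fin s → Y → ℝ := fun x y => f x.1 y
  have hrk0 : nwrk f0 = nwrk f := by
    apply le_antisymm
    · exact nwrk_comap f Prod.fst id
    · exact nwrk_comap f0 (fun x => (x, ⟨0, hs⟩)) id
  have hcX : 1 ≤ Fintype.card X := Fintype.card_pos
  obtain ⟨g, hg, hgr⟩ := nw_extend (Submodule.span ℝ (Set.range fun y x => f0 x y)) (s - nwrk f) (by
    rw [← nwrk_span, hrk0, Fintype.card_prod, Fintype.card_fin]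
    nlinarith [Nat.sub_add_cancel hr])
  rw [← nwrk_span, hrk0, Nat.add_sub_cancel' hr] at hgr
  generalize hk : s - nwrk f = k at g hg hgr
  have hks : k ≤ s := by omega
  let f1 : X × Fin s → (Y × Fin M) ⊕ Fin k → ℝ := fun x z =>
    Sum.elim (fun y => f x.1 y.1) (fun i => g i x) z
  have hf1 : NWSign f1 := by
    rintro x (y | i)
    · exact hf _ _
    · exact hg i x
  have hrk1 : nwrk f1 = s := by
    rw [nwrk_span]
    refine Eq.trans ?_ hgr
    rw [← Submodule.span_union]
    suffices hset : (Set.range fun y x => f1 x y) =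
        (Set.range fun y x => f0 x y) ∪ Set.range g by rw [hset]
    ext v
    simp only [Set.mem_range, Set.mem_union, Sum.exists, f1, Sum.elim_inl, Sum.elim_inr, f0]
    refine or_congr ⟨?_, ?_⟩ Iff.rfl
    · rintro ⟨y, hy⟩; exact ⟨y.1, hy⟩
    · rintro ⟨y, hy⟩; exact ⟨(y, ⟨0, hM0⟩), hy⟩
  obtain ⟨A', B', hc, hcard⟩ := hmono _ _ (fun p => f1 p.1 p.2) (fun p => hf1 _ _) s hs hrk1
  let A : Finset X := A'.image Prod.fst
  let B0 : Finset (Y × Fin M) := univ.filter fun y => Sum.inl y ∈ B'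
  let B : Finset Y := B0.image Prod.fst
  refine ⟨A, B, ?_, ?_⟩
  · intro x hx y hy x' hx' y' hy'
    simp only [A, B, mem_image] at hx hy hx' hy'
    obtain ⟨a, ha, rfl⟩ := hx
    obtain ⟨a', ha', rfl⟩ := hx'
    obtain ⟨b, hb, rfl⟩ := hy
    obtain ⟨b', hb', rfl⟩ := hy'
    simp only [B0, mem_filter, mem_univ, true_and] at hb hb'
    exact hc (a, Sum.inl b) (a', Sum.inl b') ha hb ha' hb'
  · have h1 : A'.card ≤ A.card * s := by
      have : A' ⊆ A ×ˢ (univ : Finset (Fin s)) := by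
        intro a ha
        simp only [mem_product, mem_univ, and_true, A]
        exact mem_image_of_mem _ ha
      simpa using card_le_card this
    have h2 : B0.card ≤ B.card * M := by
      have : B0 ⊆ B ×ˢ (univ : Finset (Fin M)) := by
        intro a ha
        simp only [mem_product, mem_univ, and_true, B]
        exact mem_image_of_mem _ ha
      simpa using card_le_card this
    have h3 : B'.card ≤ B0.card + k := by
      have : B' ⊆ B0.disjSum (univ : Finset (Fin k)) := by
        rintro (y | i) h
        · simpa [B0] using h
        · simp
      simpa using card_le_card this
    have h4 : A.card ≤ Fintype.card X := card_le_univ _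
    have h5 : (A'.card * B'.card : ℕ) ≤ (A.card * s) * (B.card * M + s) :=
      Nat.mul_le_mul h1 (by omega)
    have h5' : ((A'.card * B'.card : ℕ) : ℝ) ≤ (A.card * s) * (B.card * M + s) := by
      exact_mod_cast h5
    have h6 := hcard.le.trans h5'
    simp only [Fintype.card_prod, Fintype.card_sum, Fintype.card_fin] at h6
    push_cast at h6
    have h4' : (A.card : ℝ) ≤ Fintype.card X := by exact_mod_cast h4
    have hY1 : (1 : ℝ) ≤ Fintype.card Y := by exact_mod_cast Fintype.card_pos (α := Y)
    have hX0 : (0 : ℝ) ≤ Fintype.card X := Nat.cast_nonneg _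
    have hMpos : (0 : ℝ) < M := by exact_mod_cast hM0
    generalize (Fintype.card X : ℝ) = x at *
    generalize (Fintype.card Y : ℝ) = y at *
    generalize (A.card : ℝ) = a at *
    generalize (B.card : ℝ) = b at *
    have hk0 : (0 : ℝ) ≤ k := Nat.cast_nonneg _
    have h7 : δ * (x * (y * M)) ≤ a * (b * M + s) := by
      have e : s * (δ * (x * (y * M))) ≤ s * (a * (b * M + s)) := by
        have : 0 ≤ δ * (x * s * k) := by positivity
        nlinarith
      exact le_of_mul_le_mul_left e (by linarith)
    have h8 : a * s ≤ x * s := by nlinarith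
    have h9 : x * (2 * s) ≤ x * (y * (M * δ)) := by
      apply mul_le_mul_of_nonneg_left _ hX0
      have : 0 ≤ (M : ℝ) * δ := by positivity
      nlinarith
    have h10 : M * (δ / 2 * (x * y)) ≤ M * (a * b) := by nlinarith
    exact le_of_mul_le_mul_left h10 hMpos

lemma nw_main (c : ℕ → NNReal)
    (hmono : ∀ (X Y : Type) [Fintype X] [Fintype Y] (f : X × Y → ℝ),
      (∀ p, f p = 1 ∨ f p = -1) →
      ∀ r' : ℕ, 1 ≤ r' → (Matrix.of fun x y => f (x, y)).rank = r' →
        ∃ (A : Finset X) (B : Finset Y),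
          (∀ p q : X × Y, p.1 ∈ A → p.2 ∈ B → q.1 ∈ A → q.2 ∈ B → f p = f q) ∧
          ((A.card * B.card : ℕ) : ℝ) ≥
            2 ^ (-(c r' : ℝ)) * (Fintype.card X * Fintype.card Y : ℕ))
    (s : ℕ) (hs : 1 ≤ s) :
    ∃ n : ℕ, (n : ℝ) ≤ 2 ^ (2 + 4 * (Nat.clog 2 s : ℝ) ^ 2 +
        ∑ i ∈ Finset.range (Nat.clog 2 s + 1), (c ⌈(s : ℝ) / 2 ^ i⌉₊ : ℝ)) ∧
      ∀ (X Y : Type) [Fintype X] [Fintype Y] (f : X → Y → ℝ), NWSign f → nwrk f ≤ s →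
        NWPart f n := by
  induction s using Nat.strong_induction_on with
  | _ s ih =>
  rcases Nat.lt_or_ge s 2 with h2 | h2
  · obtain rfl : s = 1 := by omega
    refine ⟨4, ?_, ?_⟩
    · calc ((4 : ℕ) : ℝ) = 2 ^ (2 : ℝ) := by norm_num
        _ ≤ _ := Real.rpow_le_rpow_of_exponent_le (by norm_num) (by
          rw [add_assoc]
          exact le_add_of_nonneg_right (by positivity))
    · intro X Y _ _ f hf hr
      obtain ⟨X', Y', _, _, f', hf', hr', hX, hY, himp⟩ := nw_dedup f hf
      refine himp _ ((NWPart.trivial f').mono ?_)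
      have h : 2 ^ nwrk f ≤ 2 ^ 1 := Nat.pow_le_pow_right (by norm_num) hr
      exact Nat.mul_le_mul (hX.trans h) (hY.trans h)
  · obtain ⟨N, hN, hP⟩ := ih ((s + 1) / 2) (by omega) (by omega)
    set δ : ℝ := 2 ^ (-(c s : ℝ)) / 2 with hδ
    have hδ0 : 0 < δ := by positivity
    have hδ1 : δ ≤ 1 := by
      have : (2 : ℝ) ^ (-(c s : ℝ)) ≤ 1 :=
        Real.rpow_le_one_of_one_le_of_nonpos (by norm_num) (by simp)
      linarith
    refine ⟨⌈2 * s / δ⌉₊ * N, ?_, nw_step s N hs δ hδ0 hδ1 (nw_density c hmono s hs) hP⟩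
    have hk : Nat.clog 2 s = Nat.clog 2 ((s + 1) / 2) + 1 := by
      rw [Nat.clog_of_two_le (by norm_num) h2]; rfl
    set k := Nat.clog 2 ((s + 1) / 2) with hkdef
    have hsum : ∑ i ∈ Finset.range (Nat.clog 2 s + 1), (c ⌈(s : ℝ) / 2 ^ i⌉₊ : ℝ) =
        (∑ i ∈ Finset.range (k + 1), (c ⌈(((s + 1) / 2 : ℕ) : ℝ) / 2 ^ i⌉₊ : ℝ)) + c s := by
      rw [hk, Finset.sum_range_succ']
      congr 1
      · refine Finset.sum_congr rfl fun i _ => ?_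
        have : ⌈(s : ℝ) / 2 ^ (i + 1)⌉₊ = ⌈(((s + 1) / 2 : ℕ) : ℝ) / 2 ^ i⌉₊ := by
          apply eq_of_forall_ge_iff
          intro m
          rw [Nat.ceil_le, Nat.ceil_le, div_le_iff₀ (by positivity), div_le_iff₀ (by positivity)]
          have e1 : (s : ℝ) ≤ m * 2 ^ (i + 1) ↔ s ≤ m * 2 ^ (i + 1) := by exact_mod_cast Iff.rfl
          have e2 : (((s + 1) / 2 : ℕ) : ℝ) ≤ m * 2 ^ i ↔ (s + 1) / 2 ≤ m * 2 ^ i := by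
            exact_mod_cast Iff.rfl
          rw [e1, e2, pow_succ, ← mul_assoc]
          omega
        rw [this]
      · simp
    rw [hsum, hk]
    set S := ∑ i ∈ Finset.range (k + 1), (c ⌈(((s + 1) / 2 : ℕ) : ℝ) / 2 ^ i⌉₊ : ℝ) with hS
    have hsk : (s : ℝ) ≤ 2 ^ ((k : ℝ) + 1) := by
      have := Nat.le_pow_clog (b := 2) (by norm_num) s
      rw [hk] at this
      have h' : (s : ℝ) ≤ 2 ^ (k + 1) := by exact_mod_cast this
      exact_mod_cast h'
    have hj : (⌈2 * s / δ⌉₊ : ℝ) ≤ 2 ^ ((k : ℝ) + 4 + c s) := by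
      have h1 : (⌈2 * s / δ⌉₊ : ℝ) ≤ 2 * s / δ + 1 := (Nat.ceil_lt_add_one (by positivity)).le
      have h3 : 2 * s / δ = 4 * (s * 2 ^ (c s : ℝ)) := by
        rw [hδ, Real.rpow_neg (by norm_num)]
        have : (2 : ℝ) ^ (c s : ℝ) ≠ 0 := by positivity
        field_simp
        norm_num
      have h4 : (1 : ℝ) ≤ 2 ^ (c s : ℝ) := Real.one_le_rpow (by norm_num) (by simp)
      have h5 : (1 : ℝ) ≤ s := by exact_mod_cast hs
      have h6 : (1 : ℝ) ≤ s * 2 ^ (c s : ℝ) := one_le_mul_of_one_le_of_one_le h5 h4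
      calc (⌈2 * s / δ⌉₊ : ℝ) ≤ 8 * (s * 2 ^ (c s : ℝ)) := by linarith
        _ ≤ 8 * (2 ^ ((k : ℝ) + 1) * 2 ^ (c s : ℝ)) := by gcongr
        _ = 2 ^ (3 : ℝ) * (2 ^ ((k : ℝ) + 1) * 2 ^ (c s : ℝ)) := by norm_num
        _ = _ := by
          rw [← Real.rpow_add (by norm_num), ← Real.rpow_add (by norm_num)]
          congr 1; ring
    push_cast
    calc (⌈2 * s / δ⌉₊ : ℝ) * N ≤ 2 ^ ((k : ℝ) + 4 + c s) * 2 ^ (2 + 4 * (k : ℝ) ^ 2 + S) := by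
          gcongr
      _ = 2 ^ ((k : ℝ) + 4 + c s + (2 + 4 * (k : ℝ) ^ 2 + S)) := by
          rw [← Real.rpow_add (by norm_num)]
      _ ≤ _ := by
          apply Real.rpow_le_rpow_of_exponent_le (by norm_num)
          have : (0 : ℝ) ≤ k := Nat.cast_nonneg _
          nlinarith

/-- Nisan–Wigderson, combinatorial form: if every boolean function of
rank `r' ≥ 1` has a monochromatic rectangle of density `2^(-c r')`, then there is an
absolute constant `C > 0` such that every boolean function of rank `r ≥ 2` admits a
partition of `X × Y` into at most
`2^(C·(log²r + ∑_{i=0}^{⌈log₂ r⌉} c(⌈r/2^i⌉)))` monochromatic rectangles. -/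
theorem nisan_wigderson (c : ℕ → NNReal)
    (hmono : ∀ (X Y : Type) [Fintype X] [Fintype Y] (f : X × Y → ℝ),
      (∀ p, f p = 1 ∨ f p = -1) →
      ∀ r' : ℕ, 1 ≤ r' → (Matrix.of fun x y => f (x, y)).rank = r' →
        ∃ (A : Finset X) (B : Finset Y),
          (∀ p q : X × Y, p.1 ∈ A → p.2 ∈ B → q.1 ∈ A → q.2 ∈ B → f p = f q) ∧
          ((A.card * B.card : ℕ) : ℝ) ≥
            2 ^ (-(c r' : ℝ)) * (Fintype.card X * Fintype.card Y : ℕ)) :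
    ∃ C : ℝ, 0 < C ∧
      ∀ (X Y : Type) [Fintype X] [Fintype Y] (f : X × Y → ℝ),
        (∀ p, f p = 1 ∨ f p = -1) →
        ∀ r : ℕ, (Matrix.of fun x y => f (x, y)).rank = r → 2 ≤ r →
          ∃ P : Finset (Finset X × Finset Y),
            (∀ p : X × Y, ∃! R, R ∈ P ∧ p.1 ∈ R.1 ∧ p.2 ∈ R.2) ∧
            (∀ R ∈ P, ∀ p q : X × Y,
              p.1 ∈ R.1 → p.2 ∈ R.2 → q.1 ∈ R.1 → q.2 ∈ R.2 → f p = f q) ∧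
            (P.card : ℝ) ≤
              2 ^ (C * ((Real.log r) ^ 2 +
                ∑ i ∈ Finset.range (Nat.clog 2 r + 1),
                  (c ⌈(r : ℝ) / 2 ^ i⌉₊ : ℝ))) := by
  have hl2 : 0 < Real.log 2 := Real.log_pos (by norm_num)
  have hl2' : Real.log 2 ≤ 1 := by have := Real.log_two_lt_d9; linarith
  refine ⟨18 / (Real.log 2) ^ 2, by positivity, ?_⟩
  intro X Y _ _ f hf r hr h2
  obtain ⟨n, hn, hP⟩ := nw_main c hmono r (by omega)
  obtain ⟨P, hP1, hP2, hP3⟩ := (hP X Y (fun x y => f (x, y)) (fun x y => hf _) hr.le).toFinset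
  refine ⟨P, hP1, hP2, ?_⟩
  have hP3' : (P.card : ℝ) ≤ n := by exact_mod_cast hP3
  refine hP3'.trans (hn.trans (Real.rpow_le_rpow_of_exponent_le (by norm_num) ?_))
  have hS : 0 ≤ ∑ i ∈ Finset.range (Nat.clog 2 r + 1), (c ⌈(r : ℝ) / 2 ^ i⌉₊ : ℝ) := by positivity
  generalize ∑ i ∈ Finset.range (Nat.clog 2 r + 1), (c ⌈(r : ℝ) / 2 ^ i⌉₊ : ℝ) = S at hS ⊢
  have hC : 1 ≤ 18 / (Real.log 2) ^ 2 := by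
    rw [le_div_iff₀ (by positivity)]
    nlinarith
  have hr2 : (2 : ℝ) ≤ r := by exact_mod_cast h2
  have hlr : Real.log 2 ≤ Real.log r := Real.log_le_log (by norm_num) hr2
  have hk : (Nat.clog 2 r : ℝ) * Real.log 2 ≤ 2 * Real.log r := by
    have h1 := Nat.pow_pred_clog_lt_self (b := 2) (by norm_num) (x := r) (by omega)
    have h3 : 0 < Nat.clog 2 r := Nat.clog_pos (by norm_num) h2
    obtain ⟨k, hk⟩ : ∃ k, Nat.clog 2 r = k + 1 := ⟨Nat.clog 2 r - 1, by omega⟩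
    rw [hk] at h1 ⊢
    simp only [Nat.pred_eq_sub_one, Nat.add_sub_cancel] at h1
    have h4 : (2 : ℝ) ^ k ≤ r := by exact_mod_cast h1.le
    have h5 := Real.log_le_log (by positivity) h4
    rw [Real.log_pow] at h5
    push_cast
    linarith
  have hk0 : (0 : ℝ) ≤ Nat.clog 2 r := Nat.cast_nonneg _
  generalize (Nat.clog 2 r : ℝ) = k at hk hk0 ⊢
  have h6 : (k * Real.log 2) ^ 2 ≤ (2 * Real.log r) ^ 2 := pow_le_pow_left₀ (by positivity) hk 2
  have h7 : Real.log 2 ^ 2 ≤ Real.log r ^ 2 := pow_le_pow_left₀ hl2.le hlr 2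
  have h8 : 2 + 4 * k ^ 2 ≤ 18 / (Real.log 2) ^ 2 * Real.log r ^ 2 := by
    rw [div_mul_eq_mul_div, le_div_iff₀ (by positivity)]
    nlinarith
  have h9 : S ≤ 18 / (Real.log 2) ^ 2 * S := le_mul_of_one_le_left hS hC
  linarith
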